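/- Fix an integer N ≥ 2. For every regular linear transformation T, the set R_T := {x ∈ [0,1] : the sequence (Π^T(x,m))_m accumulates at every point of Δ_N} has packing dimension 1. -/

import Mathlib

open Filter Topology

/-- The `j`-th digit (for `j ≥ 1`) of the unique non-terminating base-`N` expansion
of `x ∈ [0,1]`. -/
noncomputable def digit (N : ℕ) (x : ℝ) (j : ℕ) : ℕ :=
  (⌈(N : ℝ) ^ j * x⌉ - (N : ℤ) * ⌈(N : ℝ) ^ (j - 1) * x⌉ + (N : ℤ) - 1).toNat

/-- `freqVec N x n i = Π_i(x,n)`, the frequency of digit `i` among the first `n` digits. -/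
noncomputable def freqVec (N : ℕ) (x : ℝ) (n : ℕ) : Fin N → ℝ :=
  fun i => (((Finset.Icc 1 n).filter (fun j => digit N x j = i.val)).card : ℝ) / n

/-- `p` is an accumulation point of the sequence `v` w.r.t. the ℓ¹ norm. -/
def IsAccPt1 (N : ℕ) (v : ℕ → Fin N → ℝ) (p : Fin N → ℝ) : Prop :=
  ∃ φ : ℕ → ℕ, StrictMono φ ∧
    Tendsto (fun u => ∑ k, |v (φ u) k - p k|) atTop (𝓝 0)

/-- The series `Σ f n` converges (in the classical sense) to `t`. -/
def SeriesTo (f : ℕ → ℝ) (t : ℝ) : Prop :=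
  Tendsto (fun K => ∑ n ∈ Finset.range K, f n) atTop (𝓝 t)

/-- `c` is a linear transformation: the series `Σ_n c m n * s n` converges for every
convergent sequence `s` and every row `m`. -/
def IsLinTrans (c : ℕ → ℕ → ℝ) : Prop :=
  ∀ s : ℕ → ℝ, (∃ l, Tendsto s atTop (𝓝 l)) → ∀ m, ∃ t, SeriesTo (fun n => c m n * s n) t

/-- `c` is a regular linear transformation: moreover, the averaged sequence converges to
the same limit. -/
def IsRegularLT (c : ℕ → ℕ → ℝ) : Prop :=
  IsLinTrans c ∧
    ∀ (s : ℕ → ℝ) (l : ℝ), Tendsto s atTop (𝓝 l) →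
      ∀ t : ℕ → ℝ, (∀ m, SeriesTo (fun n => c m n * s n) (t m)) →
        Tendsto t atTop (𝓝 l)

/-- The `T`-averaged digit frequency vector `Π^T(x,m)`. -/
noncomputable def freqT (N : ℕ) (c : ℕ → ℕ → ℝ) (x : ℝ) (m : ℕ) : Fin N → ℝ :=
  fun i => ∑' n, c m n * freqVec N x n i

/-- `𝔻`: rational probability vectors except `(1,0,...,0)` and `(0,...,0,1)`. -/
def Dset (N : ℕ) : Set (Fin N → ℝ) :=
  {q | q ∈ stdSimplex ℝ (Fin N) ∧ (∀ i, ∃ r : ℚ, q i = (r : ℝ)) ∧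
    q ≠ (fun i => if i.val = 0 then 1 else 0) ∧
    q ≠ (fun i => if i.val = N - 1 then 1 else 0)}

/-- `𝕀`: points of `[0,1]` with non-terminating base-`N` expansion. -/
def Iset (N : ℕ) : Set ℝ :=
  {x | x ∈ Set.Icc (0 : ℝ) 1 ∧ ¬∃ n k : ℕ, k < N ^ n ∧ x = (k : ℝ) / (N : ℝ) ^ n}

/-- Property `P_{h,ψ}` of a sequence in `ℝ^N`. -/
def PropP (N h : ℕ) (ψ : ℕ → ℕ) (v : ℕ → Fin N → ℝ) : Prop :=
  ∀ i m : ℕ, ∀ q ∈ Dset N, ∃ j : ℕ, i ≤ j ∧ (j : ℝ) / (ψ j : ℝ) ≤ 1 / (h : ℝ) ∧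
    ∀ n : ℕ, j ≤ n → n ≤ ψ^[m] j → ∑ k, |v n k - q k| < 1 / (h : ℝ)

/-- Number of grid intervals of length `1/n` meeting `E`. -/
noncomputable def boxCount (E : Set ℝ) (n : ℕ) : ℕ∞ :=
  {k : ℤ | (E ∩ Set.Ico ((k : ℝ) / n) (((k : ℝ) + 1) / n)).Nonempty}.encard

/-- Upper box (Minkowski) dimension of a subset of `ℝ`. -/
noncomputable def upperBoxDim (E : Set ℝ) : EReal :=
  Filter.limsup (fun n : ℕ =>
    if boxCount E n = ⊤ then (⊤ : EReal)
    else ((Real.log (boxCount E n).toNat / Real.log n : ℝ) : EReal)) Filter.atTop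

/-- Packing dimension of a subset of `ℝ`, via countable covers:
`dim_P F = inf { sup_n upperBoxDim (E n) : F ⊆ ⋃ n, E n }`. -/
noncomputable def packingDim (F : Set ℝ) : EReal :=
  sInf ((fun E : ℕ → Set ℝ => ⨆ n, upperBoxDim (E n)) '' {E | F ⊆ ⋃ n, E n})

lemma summable_abs_of_forall_seriesTo {f : ℕ → ℝ}
    (h : ∀ s : ℕ → ℝ, Tendsto s atTop (𝓝 0) → ∃ t, SeriesTo (fun n => f n * s n) t) :
    Summable (fun n => |f n|) := by
  by_contra hf
  rw [not_summable_iff_tendsto_nat_atTop_of_nonneg (fun n => abs_nonneg (f n))] at hf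
  set S : ℕ → ℝ := fun n => 1 + ∑ k ∈ Finset.range n, |f k| with hS
  have hS_top : Tendsto S atTop atTop := tendsto_atTop_add_const_left _ _ hf
  have hS_pos : ∀ n, 0 < S n := fun n => by
    have : 0 ≤ ∑ k ∈ Finset.range n, |f k| := Finset.sum_nonneg fun _ _ => abs_nonneg _
    simp only [hS]; linarith
  have hS_mono : Monotone S := monotone_nat_of_le_succ fun n => by
    simp only [hS, Finset.sum_range_succ]
    have := abs_nonneg (f n)
    linarith
  obtain ⟨t, ht⟩ := h (fun n => SignType.sign (f n) / S (n + 1)) <| by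
    have h1 : Tendsto (fun n => (S (n + 1))⁻¹) atTop (𝓝 0) :=
      tendsto_inv_atTop_zero.comp (hS_top.comp (tendsto_add_atTop_nat 1))
    refine squeeze_zero_norm (fun n => ?_) h1
    rw [norm_div, Real.norm_eq_abs, Real.norm_eq_abs, abs_of_pos (hS_pos _), div_eq_mul_inv]
    refine mul_le_of_le_one_left (inv_nonneg.2 (hS_pos _).le) ?_
    rcases lt_trichotomy (f n) 0 with h | h | h <;> simp [h]
  have hterm : ∀ n, f n * (SignType.sign (f n) / S (n + 1)) = |f n| / S (n + 1) := fun n => by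
    rw [← mul_div_assoc, self_mul_sign]
  simp only [SeriesTo, hterm] at ht
  obtain ⟨n₀, hn₀⟩ := Metric.cauchySeq_iff'.1 ht.cauchySeq (1 / 2) (by norm_num)
  obtain ⟨m, hm₁, hm₂⟩ :=
    ((hS_top.eventually_ge_atTop (2 * S n₀)).and (eventually_ge_atTop n₀)).exists
  have hlt := hn₀ m hm₂
  rw [Real.dist_eq, ← Finset.sum_Ico_eq_sub _ hm₂] at hlt
  have hge : (S m - S n₀) / S m ≤ ∑ k ∈ Finset.Ico n₀ m, |f k| / S (k + 1) := by
    have : S m - S n₀ = ∑ k ∈ Finset.Ico n₀ m, |f k| := by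
      rw [Finset.sum_Ico_eq_sub _ hm₂]; simp only [hS]; ring
    rw [this, Finset.sum_div]
    refine Finset.sum_le_sum fun k hk => ?_
    exact div_le_div_of_nonneg_left (abs_nonneg _) (hS_pos _)
      (hS_mono (Finset.mem_Ico.1 hk).2)
  have : 1 / 2 ≤ (S m - S n₀) / S m := by
    rw [div_le_div_iff₀ (by norm_num) (hS_pos m)]
    linarith
  linarith [le_abs_self (∑ k ∈ Finset.Ico n₀ m, |f k| / S (k + 1))]

lemma IsRegularLT.summable_abs {c : ℕ → ℕ → ℝ} (hc : IsRegularLT c) (m : ℕ) :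
    Summable (fun n => |c m n|) :=
  summable_abs_of_forall_seriesTo fun s hs => hc.1 s ⟨0, hs⟩ m

lemma freqVec_nonneg (N : ℕ) (x : ℝ) (n : ℕ) (i : Fin N) : 0 ≤ freqVec N x n i := by
  unfold freqVec; positivity

lemma freqVec_le_one (N : ℕ) (x : ℝ) (n : ℕ) (i : Fin N) : freqVec N x n i ≤ 1 := by
  refine div_le_one_of_le₀ ?_ (Nat.cast_nonneg n)
  exact_mod_cast (Finset.card_filter_le _ _).trans (by simp)

lemma abs_mul_freqVec_le (N : ℕ) (a x : ℝ) (n : ℕ) (i : Fin N) :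
    |a * freqVec N x n i| ≤ |a| := by
  rw [abs_mul, abs_of_nonneg (freqVec_nonneg N x n i)]
  exact mul_le_of_le_one_right (abs_nonneg _) (freqVec_le_one N x n i)

lemma IsRegularLT.tendsto_freqT {N : ℕ} {c : ℕ → ℕ → ℝ} (hc : IsRegularLT c) {x : ℝ}
    {i : Fin N} {l : ℝ} (h : Tendsto (fun n => freqVec N x n i) atTop (𝓝 l)) :
    Tendsto (fun m => freqT N c x m i) atTop (𝓝 l) := by
  refine hc.2 _ l h _ fun m => ?_
  exact (Summable.of_norm_bounded (hc.summable_abs m)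
    fun n => abs_mul_freqVec_le N (c m n) x n i).hasSum.tendsto_sum_nat

lemma eventually_ceil_mul_eq {a : ℝ} (ha : 0 ≤ a) (x : ℝ) :
    ∀ᶠ y in 𝓝[<] x, ⌈a * y⌉ = ⌈a * x⌉ := by
  have h1 : ∀ᶠ y in 𝓝[<] x, (⌈a * x⌉ : ℝ) - 1 < a * y :=
    (((continuous_const_mul a).tendsto x).mono_left nhdsWithin_le_nhds).eventually_const_lt
      (by linarith [Int.ceil_lt_add_one (a * x)])
  filter_upwards [h1, self_mem_nhdsWithin] with y hy hyx
  exact Int.ceil_eq_iff.2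
    ⟨hy, (mul_le_mul_of_nonneg_left (le_of_lt hyx) ha).trans (Int.le_ceil _)⟩

lemma eventually_freqVec_eq (N : ℕ) (x : ℝ) (n : ℕ) :
    ∀ᶠ y in 𝓝[<] x, freqVec N y n = freqVec N x n := by
  have h : ∀ j, ∀ᶠ y in 𝓝[<] x, digit N y j = digit N x j := fun j => by
    filter_upwards [eventually_ceil_mul_eq (a := (N : ℝ) ^ j) (by positivity) x,
      eventually_ceil_mul_eq (a := (N : ℝ) ^ (j - 1)) (by positivity) x] with y h1 h2
    rw [digit, digit, h1, h2]
  filter_upwards [(Filter.eventually_all_finset (Finset.Icc 1 n)).2 fun j _ => h j] with y hy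
  funext i
  unfold freqVec
  rw [Finset.filter_congr fun j hj => by rw [hy j hj]]

lemma IsRegularLT.tendsto_freqT_left (N : ℕ) {c : ℕ → ℕ → ℝ} (hc : IsRegularLT c) (x : ℝ)
    (m : ℕ) (i : Fin N) :
    Tendsto (fun y => freqT N c y m i) (𝓝[<] x) (𝓝 (freqT N c x m i)) := by
  refine tendsto_tsum_of_dominated_convergence (hc.summable_abs m) (fun n => ?_)
    (Eventually.of_forall fun y n => abs_mul_freqVec_le N (c m n) y n i)
  refine tendsto_const_nhds.congr' ?_
  filter_upwards [eventually_freqVec_eq N x n] with y hy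
  rw [hy]

lemma digit_add_int_div_pow {N : ℕ} (hN : N ≠ 0) (a : ℤ) (k : ℕ) (x : ℝ) (j : ℕ) :
    digit N ((a + x) / (N : ℝ) ^ k) (k + j + 1) = digit N x (j + 1) := by
  have hN' : (N : ℝ) ≠ 0 := Nat.cast_ne_zero.2 hN
  have h : ∀ i : ℕ, ⌈(N : ℝ) ^ (k + i) * ((a + x) / (N : ℝ) ^ k)⌉
      = ⌈(N : ℝ) ^ i * x⌉ + (N : ℤ) ^ i * a := fun i => by
    rw [← Int.ceil_add_intCast]
    congr 1
    push_cast
    field_simp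
    ring
  rw [digit, digit, add_assoc, h, Nat.add_sub_cancel, ← add_assoc, Nat.add_sub_cancel, h]
  congr 1
  ring

lemma ofDigits_pos {N : ℕ} {d : ℕ → Fin N} {n : ℕ} (h : (d n : ℕ) ≠ 0) :
    0 < Real.ofDigits d := by
  refine Real.summable_ofDigitsTerm.tsum_pos (fun _ => Real.ofDigitsTerm_nonneg) n ?_
  have : 0 < N := Fin.pos (d 0)
  have : 0 < (d n : ℕ) := Nat.pos_of_ne_zero h
  unfold Real.ofDigitsTerm
  positivity

lemma digit_ofDigits {N : ℕ} {d : ℕ → Fin N} (h : ∀ n, ∃ m, (d (n + m) : ℕ) ≠ 0) (j : ℕ) :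
    digit N (Real.ofDigits d) (j + 1) = d j := by
  have hN : (N : ℝ) ≠ 0 := Nat.cast_ne_zero.2 (Fin.pos (d 0)).ne'
  have hceil : ∀ k : ℕ, ⌈(N : ℝ) ^ k * Real.ofDigits d⌉
      = ∑ i ∈ Finset.range k, (d i : ℤ) * (N : ℤ) ^ (k - 1 - i) + 1 := fun k => by
    have hsum : (N : ℝ) ^ k * ∑ i ∈ Finset.range k, Real.ofDigitsTerm d i
        = ((∑ i ∈ Finset.range k, (d i : ℤ) * (N : ℤ) ^ (k - 1 - i) : ℤ) : ℝ) := by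
      push_cast
      rw [Finset.mul_sum]
      refine Finset.sum_congr rfl fun i hi => ?_
      obtain ⟨l, rfl⟩ := Nat.exists_eq_add_of_lt (Finset.mem_range.1 hi)
      rw [Real.ofDigitsTerm, show i + l + 1 - 1 - i = l by omega]
      field_simp
      ring
    obtain ⟨m, hm⟩ := h k
    have hpos : 0 < Real.ofDigits (fun i => d (i + k)) :=
      ofDigits_pos (n := m) (by rwa [add_comm m k])
    have hle := Real.ofDigits_le_one (fun i => d (i + k))
    rw [Real.ofDigits_eq_sum_add_ofDigits d k, mul_add, hsum, ← mul_assoc,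
      mul_inv_cancel₀ (pow_ne_zero _ hN), one_mul, Int.ceil_intCast_add]
    congr 1
    exact Int.ceil_eq_iff.2 ⟨by simpa using hpos, by simpa using hle⟩
  have hrec : ∑ i ∈ Finset.range (j + 1), (d i : ℤ) * (N : ℤ) ^ (j + 1 - 1 - i)
      = N * ∑ i ∈ Finset.range j, (d i : ℤ) * (N : ℤ) ^ (j - 1 - i) + d j := by
    rw [Finset.sum_range_succ, Finset.mul_sum]
    congr 1
    · refine Finset.sum_congr rfl fun i hi => ?_
      obtain ⟨l, rfl⟩ := Nat.exists_eq_add_of_lt (Finset.mem_range.1 hi)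
      rw [show i + l + 1 + 1 - 1 - i = l + 1 by omega, show i + l + 1 - 1 - i = l by omega]
      ring
    · simp
  rw [digit, hceil, hrec, Nat.add_sub_cancel, hceil]
  ring_nf
  simp

lemma exists_forall_abs_le_of_eventually_periodic {f : ℕ → ℝ} {k s : ℕ} (hs : s ≠ 0)
    (hf : ∀ n, k ≤ n → f (n + s) = f n) : ∃ B, ∀ n, |f n| ≤ B := by
  refine ⟨∑ i ∈ Finset.range (k + s), |f i|, fun n => ?_⟩
  induction n using Nat.strong_induction_on with
  | _ n ih =>
    by_cases hn : n < k + s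
    · exact Finset.single_le_sum (f := fun i => |f i|) (fun _ _ => abs_nonneg _)
        (Finset.mem_range.2 hn)
    · have := ih (n - s) (by omega)
      rwa [← hf (n - s) (by omega), Nat.sub_add_cancel (by omega)] at this

lemma freqVec_eq_count (N : ℕ) (x : ℝ) (n : ℕ) (i : Fin N) :
    freqVec N x n i = (Nat.count (fun j => digit N x (j + 1) = i) n : ℝ) / n := by
  rw [freqVec, Nat.count_eq_card_filter_range]
  congr 2
  refine Finset.card_bij' (fun j _ => j - 1) (fun j _ => j + 1) ?_ ?_ ?_ ?_ <;>
    simp only [Finset.mem_filter, Finset.mem_Icc, Finset.mem_range]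
  · rintro j ⟨hj, h⟩
    exact ⟨by omega, by rwa [Nat.sub_add_cancel hj.1]⟩
  · rintro j ⟨hj, h⟩
    exact ⟨by omega, h⟩
  · rintro j ⟨hj, h⟩
    omega
  · rintro j -
    omega

lemma tendsto_freqVec_of_periodic {N : ℕ} {x : ℝ} {k s : ℕ} (hs : s ≠ 0)
    {d : ℕ → Fin N} (hd : Function.Periodic d s)
    (hx : ∀ j, digit N x (k + j + 1) = d j) (i : Fin N) :
    Tendsto (fun n => freqVec N x n i) atTop (𝓝 (Nat.count (fun j => d j = i) s / s)) := by
  set p : ℕ → Prop := fun j => digit N x (j + 1) = i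
  set A := Nat.count (fun j => d j = i) s
  have hs' : (s : ℝ) ≠ 0 := Nat.cast_ne_zero.2 hs
  have hcount : ∀ n, k ≤ n → Nat.count p (n + s) = Nat.count p n + A := by
    intro n hn
    obtain ⟨l, rfl⟩ := Nat.exists_eq_add_of_le hn
    rw [Nat.count_add]
    congr 1
    have : (fun j => p (k + l + j)) = fun j => d (l + j) = i := by
      funext j
      simp only [p, add_assoc k l j, hx, Fin.val_inj]
    simp only [this]
    rw [show A = _ from (Nat.filter_Ico_card_eq_of_periodic l s (fun j => d j = i)
      (fun j => by simp only [hd j])).symm, Nat.count_eq_card_filter_range]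
    refine Finset.card_bij' (fun j _ => l + j) (fun j _ => j - l) ?_ ?_ ?_ ?_ <;>
      simp only [Finset.mem_filter, Finset.mem_Ico, Finset.mem_range]
    · rintro j ⟨hj, h⟩
      exact ⟨by omega, h⟩
    · rintro j ⟨hj, h⟩
      exact ⟨by omega, by rwa [Nat.add_sub_cancel' hj.1]⟩
    · rintro j -
      omega
    · rintro j ⟨hj, h⟩
      omega
  obtain ⟨B, hB⟩ := exists_forall_abs_le_of_eventually_periodic
    (f := fun n => (Nat.count p n : ℝ) - A / s * n) (k := k) hs fun n hn => by
      simp only [hcount n hn]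
      push_cast
      field_simp
      ring
  rw [tendsto_iff_norm_sub_tendsto_zero]
  refine squeeze_zero' (Eventually.of_forall fun _ => norm_nonneg _) ?_
    (tendsto_const_nhds.div_atTop (tendsto_natCast_atTop_atTop (R := ℝ)) (a := B))
  filter_upwards [eventually_gt_atTop 0] with n hn
  have hn' : (0 : ℝ) < n := Nat.cast_pos.2 hn
  rw [freqVec_eq_count, Real.norm_eq_abs, le_div_iff₀ hn', ← abs_of_pos hn', ← abs_mul,
    abs_of_pos hn', sub_mul, div_mul_cancel₀ _ hn'.ne']
  exact hB n

lemma exists_periodic_count_eq {N : ℕ} (a : Fin N → ℕ) (ha : ∑ i, a i ≠ 0) :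
    ∃ d : ℕ → Fin N, Function.Periodic d (∑ i, a i) ∧
      ∀ i, Nat.count (fun j => d j = i) (∑ i, a i) = a i := by
  set s := ∑ i, a i
  obtain ⟨e⟩ : Nonempty (Fin s ≃ Σ i, Fin (a i)) := ⟨finSigmaFinEquiv.symm⟩
  refine ⟨fun n => (e ⟨n % s, Nat.mod_lt _ (Nat.pos_of_ne_zero ha)⟩).1, fun n => by simp,
    fun i => ?_⟩
  rw [Nat.count_eq_card_filter_range, Finset.card_filter, Finset.sum_range]
  simp only [Nat.mod_eq_of_lt (Fin.is_lt _), Fin.eta]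
  rw [Equiv.sum_comp e (fun b => if b.1 = i then 1 else 0), Fintype.sum_sigma]
  simp [apply_ite Finset.card]

/-- Numbers whose digit frequencies converge to a given positive rational vector are dense. -/
lemma dense_tendsto_freqVec {N : ℕ} (hN : 2 ≤ N) (a : Fin N → ℕ) (ha : ∀ i, a i ≠ 0) :
    Dense {x : ℝ | ∀ i, Tendsto (fun n => freqVec N x n i) atTop
      (𝓝 (a i / (∑ i, a i : ℕ)))} := by
  have hs : ∑ i, a i ≠ 0 := fun h =>
    ha ⟨0, by omega⟩ (Finset.sum_eq_zero_iff.1 h _ (Finset.mem_univ _))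
  obtain ⟨d, hd, hcount⟩ := exists_periodic_count_eq a hs
  have hnz : ∀ n, ∃ m, (d (n + m) : ℕ) ≠ 0 := by
    intro n
    obtain ⟨j, -, hj⟩ : ∃ j < ∑ i, a i, d j = ⟨1, hN⟩ := by
      by_contra! h
      refine ha ⟨1, hN⟩ ?_
      rw [← hcount, Nat.count_eq_card_filter_range, Finset.card_eq_zero,
        Finset.filter_eq_empty_iff]
      exact fun j hj => h j (Finset.mem_range.1 hj)
    have hle : n ≤ j + n * ∑ i, a i :=
      (Nat.le_mul_of_pos_right n (Nat.pos_of_ne_zero hs)).trans (Nat.le_add_left _ _)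
    refine ⟨j + n * ∑ i, a i - n, ?_⟩
    have hper := hd.nat_mul n j
    rw [Nat.cast_id] at hper
    rw [Nat.add_sub_cancel' hle, hper, hj]
    exact one_ne_zero
  rw [Metric.dense_iff]
  intro y r hr
  obtain ⟨k, hk⟩ := exists_pow_lt_of_lt_one hr
    (inv_lt_one_of_one_lt₀ (by exact_mod_cast hN : (1 : ℝ) < N))
  have hNk : (0 : ℝ) < (N : ℝ) ^ k := by positivity
  refine ⟨(⌊(N : ℝ) ^ k * y⌋ + Real.ofDigits d) / (N : ℝ) ^ k, ?_, fun i => ?_⟩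
  · rw [Metric.mem_ball, Real.dist_eq]
    refine lt_of_le_of_lt ?_ hk
    rw [inv_pow, ← one_div, le_div_iff₀ hNk, ← abs_of_pos hNk, ← abs_mul, abs_of_pos hNk, sub_mul,
      div_mul_cancel₀ _ hNk.ne', abs_le]
    have h1 := Int.floor_le ((N : ℝ) ^ k * y)
    have h2 := Int.lt_floor_add_one ((N : ℝ) ^ k * y)
    have h3 := Real.ofDigits_nonneg d
    have h4 := Real.ofDigits_le_one d
    constructor <;> linarith
  · rw [← hcount i]
    exact tendsto_freqVec_of_periodic hs hd
      (fun j => by rw [digit_add_int_div_pow (by omega), digit_ofDigits hnz]) i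

lemma exists_nat_weights_near {N : ℕ} {p : Fin N → ℝ} (hp : p ∈ stdSimplex ℝ (Fin N)) {ε : ℝ}
    (hε : 0 < ε) :
    ∃ a : Fin N → ℕ, (∀ i, a i ≠ 0) ∧
      ∑ i, |(a i : ℝ) / (∑ i, a i : ℕ) - p i| < ε := by
  obtain ⟨K, hK⟩ := exists_nat_gt (max 0 (N * (1 + N) / ε))
  have hK0 : (0 : ℝ) < K := (le_max_left _ _).trans_lt hK
  have hKε : N * (1 + N) / ε < (K : ℝ) := (le_max_right _ _).trans_lt hK
  set a : Fin N → ℕ := fun i => ⌊K * p i⌋₊ + 1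
  have ha : ∀ i, K * p i ≤ a i ∧ (a i : ℝ) ≤ K * p i + 1 := fun i => by
    have h0 : 0 ≤ K * p i := mul_nonneg hK0.le (hp.1 i)
    have h1 := Nat.floor_le h0
    have h2 := Nat.lt_floor_add_one (K * p i)
    simp only [a]
    push_cast
    constructor <;> linarith
  set s : ℝ := ((∑ i, a i : ℕ) : ℝ) with hs
  have hKs : K ≤ s := by
    calc (K : ℝ) = ∑ i, K * p i := by rw [← Finset.mul_sum, hp.2, mul_one]
      _ ≤ s := by rw [hs]; push_cast; exact Finset.sum_le_sum fun i _ => (ha i).1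
  have hsK : s ≤ K + N := by
    calc s ≤ ∑ i, (K * p i + 1) := by
          rw [hs]; push_cast; exact Finset.sum_le_sum fun i _ => (ha i).2
      _ = K + N := by rw [Finset.sum_add_distrib, ← Finset.mul_sum, hp.2]; simp
  have hs0 : 0 < s := hK0.trans_le hKs
  refine ⟨a, fun i => Nat.succ_ne_zero _, ?_⟩
  have hterm : ∀ i, |(a i : ℝ) / s - p i| ≤ (1 + N) / K := fun i => by
    have hpi : p i ≤ 1 := by
      rw [← hp.2]
      exact Finset.single_le_sum (fun j _ => hp.1 j) (Finset.mem_univ i)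
    have h0 := hp.1 i
    refine le_trans ?_ (div_le_div_of_nonneg_left (by positivity) hK0 hKs)
    rw [div_sub' hs0.ne', abs_div, abs_of_pos hs0]
    refine div_le_div_of_nonneg_right ?_ hs0.le
    obtain ⟨h1, h2⟩ := ha i
    rw [abs_le]
    constructor <;> nlinarith
  calc ∑ i, |(a i : ℝ) / s - p i| ≤ ∑ _i : Fin N, (1 + N : ℝ) / K :=
        Finset.sum_le_sum fun i _ => hterm i
    _ = N * (1 + N) / K := by simp [mul_div_assoc]
    _ < ε := by
      rw [div_lt_iff₀ hε] at hKε
      rw [div_lt_iff₀ hK0]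
      linarith

lemma IsRegularLT.dense_interior_freqT_near {N : ℕ} (hN : 2 ≤ N) {c : ℕ → ℕ → ℝ}
    (hc : IsRegularLT c) {a : Fin N → ℕ} (ha : ∀ i, a i ≠ 0) (M : ℕ) {ε : ℝ} (hε : 0 < ε) :
    Dense (interior {x : ℝ | ∃ m, M ≤ m ∧
      ∑ i, |freqT N c x m i - a i / (∑ i, a i : ℕ)| < ε}) := by
  rw [dense_iff_inter_open]
  intro U hU hne
  obtain ⟨x, hxU, hx⟩ := dense_iff_inter_open.1 (dense_tendsto_freqVec hN a ha) U hU hne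
  have hlim : Tendsto (fun m => ∑ i, |freqT N c x m i - a i / (∑ i, a i : ℕ)|) atTop (𝓝 0) := by
    have := tendsto_finsetSum Finset.univ fun i _ =>
      ((hc.tendsto_freqT (hx i)).sub_const ((a i : ℝ) / (∑ i, a i : ℕ))).abs
    simpa using this
  obtain ⟨m, hmM, hm⟩ := ((eventually_ge_atTop M).and (hlim.eventually_lt_const hε)).exists
  have hleft : Tendsto (fun y => ∑ i, |freqT N c y m i - a i / (∑ i, a i : ℕ)|) (𝓝[<] x)
      (𝓝 (∑ i, |freqT N c x m i - a i / (∑ i, a i : ℕ)|)) :=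
    tendsto_finsetSum Finset.univ fun i _ =>
      ((hc.tendsto_freqT_left N x m i).sub_const _).abs
  have hev := (hleft.eventually_lt_const hm).and (nhdsWithin_le_nhds (hU.mem_nhds hxU))
  obtain ⟨l, hl, hsub⟩ := mem_nhdsLT_iff_exists_Ioo_subset.1 hev
  obtain ⟨y, hy⟩ := Set.nonempty_Ioo.2 (Set.mem_Iio.1 hl)
  exact ⟨y, (hsub hy).2, mem_interior.2
    ⟨Set.Ioo l x, fun z hz => ⟨m, hmM, (hsub hz).1⟩, isOpen_Ioo, hy⟩⟩

lemma isAccPt1_of_frequently {N : ℕ} {v : ℕ → Fin N → ℝ} {p : Fin N → ℝ}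
    (h : ∀ ε > 0, ∀ M, ∃ m, M ≤ m ∧ ∑ i, |v m i - p i| < ε) : IsAccPt1 N v p := by
  obtain ⟨φ, hφ, hlt⟩ := extraction_forall_of_frequently
    (P := fun n m => ∑ i, |v m i - p i| < 1 / ((n : ℝ) + 1))
    fun n => frequently_atTop.2 fun M => h _ Nat.one_div_pos_of_nat M
  exact ⟨φ, hφ, squeeze_zero (fun n => Finset.sum_nonneg fun _ _ => abs_nonneg _)
    (fun n => (hlt n).le) tendsto_one_div_add_atTop_nhds_zero_nat⟩

/-- Accumulating `T`-averaged frequencies at every probability vector is a generic property. -/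
lemma IsRegularLT.eventually_residual_isAccPt1 {N : ℕ} (hN : 2 ≤ N) {c : ℕ → ℕ → ℝ}
    (hc : IsRegularLT c) :
    ∀ᶠ x in residual ℝ, ∀ p ∈ stdSimplex ℝ (Fin N), IsAccPt1 N (freqT N c x) p := by
  have h : ∀ᶠ x in residual ℝ, ∀ (a : {a : Fin N → ℕ // ∀ i, a i ≠ 0}) (M k : ℕ),
      ∃ m, M ≤ m ∧ ∑ i, |freqT N c x m i - a.1 i / (∑ i, a.1 i : ℕ)| < 1 / ((k : ℝ) + 1) := by
    simp only [eventually_countable_forall]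
    intro a M k
    exact mem_of_superset (residual_of_dense_open isOpen_interior
      (hc.dense_interior_freqT_near hN a.2 M Nat.one_div_pos_of_nat)) interior_subset
  filter_upwards [h] with x hx p hp
  refine isAccPt1_of_frequently fun ε hε M => ?_
  obtain ⟨a, ha, hap⟩ := exists_nat_weights_near hp (half_pos hε)
  obtain ⟨k, hk⟩ := exists_nat_one_div_lt (half_pos hε)
  obtain ⟨m, hm, hlt⟩ := hx ⟨a, ha⟩ M k
  refine ⟨m, hm, ?_⟩
  calc ∑ i, |freqT N c x m i - p i|
      ≤ ∑ i, (|freqT N c x m i - a i / (∑ i, a i : ℕ)| + |(a i : ℝ) / (∑ i, a i : ℕ) - p i|) :=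
        Finset.sum_le_sum fun i _ => abs_sub_le _ _ _
    _ = _ := Finset.sum_add_distrib
    _ < ε := by linarith

lemma le_boxCount_of_Ioo_subset_closure {E : Set ℝ} {u v : ℝ} (h : Set.Ioo u v ⊆ closure E)
    {n : ℕ} (hn : 0 < n) : ((⌊n * (v - u)⌋₊ - 2 : ℕ) : ℕ∞) ≤ boxCount E n := by
  have hn' : (0 : ℝ) < n := Nat.cast_pos.2 hn
  set K := ⌊n * (v - u)⌋₊
  by_cases hK : K < 2
  · simp [Nat.sub_eq_zero_of_le hK.le]
  have hKle : (K : ℝ) ≤ n * (v - u) := Nat.floor_le (Nat.pos_of_floor_pos (by omega)).le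
  rw [boxCount]
  have hsub : ((Finset.Ico ⌈n * u⌉ (⌈n * u⌉ + (K - 2 : ℕ)) : Finset ℤ) : Set ℤ) ⊆
      {k : ℤ | (E ∩ Set.Ico ((k : ℝ) / n) (((k : ℝ) + 1) / n)).Nonempty} := by
    intro k hk
    rw [Finset.coe_Ico, Set.mem_Ico] at hk
    have h1 : (n : ℝ) * u ≤ k := (Int.le_ceil _).trans (by exact_mod_cast hk.1)
    have h2 : (k : ℝ) + 1 ≤ n * v := by
      have : (k : ℝ) + 1 ≤ ⌈n * u⌉ + (K - 2 : ℕ) := by exact_mod_cast hk.2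
      rw [Nat.cast_sub (by omega)] at this
      push_cast at this
      linarith [Int.ceil_lt_add_one (n * u)]
    have hlt : (k : ℝ) / n < ((k : ℝ) + 1) / n := by gcongr; linarith
    obtain ⟨y, hy⟩ := Set.nonempty_Ioo.2 hlt
    have hyuv : y ∈ Set.Ioo u v := by
      refine ⟨lt_of_le_of_lt ?_ hy.1, lt_of_lt_of_le hy.2 ?_⟩
      · rw [le_div_iff₀ hn']; linarith
      · rw [div_le_iff₀ hn']; linarith
    obtain ⟨z, hz, hzE⟩ := mem_closure_iff.1 (h hyuv) _ isOpen_Ioo hy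
    exact ⟨z, hzE, hz.1.le, hz.2⟩
  refine le_trans ?_ (Set.encard_le_encard hsub)
  rw [Set.encard_coe_eq_coe_finsetCard]
  simp

lemma tendsto_log_add_log_div_log (δ : ℝ) :
    Tendsto (fun n : ℕ => (Real.log n + δ) / Real.log n) atTop (𝓝 1) := by
  have hlog : Tendsto (fun n : ℕ => Real.log n) atTop atTop :=
    Real.tendsto_log_atTop.comp tendsto_natCast_atTop_atTop
  have h := (tendsto_const_nhds (x := (1 : ℝ))).add
    ((tendsto_const_nhds (x := δ)).div_atTop hlog)
  rw [add_zero] at h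
  refine h.congr' ?_
  filter_upwards [hlog.eventually_gt_atTop 0] with n hn
  rw [add_div, div_self hn.ne']

lemma one_le_upperBoxDim_of_nonempty_interior_closure {E : Set ℝ}
    (h : (interior (closure E)).Nonempty) : 1 ≤ upperBoxDim E := by
  obtain ⟨x, hx⟩ := h
  obtain ⟨u, v, hxuv, huv⟩ := mem_nhds_iff_exists_Ioo_subset.1 (mem_interior_iff_mem_nhds.1 hx)
  set δ := (v - u) / 2
  have hδ : 0 < δ := half_pos (by linarith [hxuv.1, hxuv.2])
  have hlim : Tendsto (fun n : ℕ => (((Real.log n + Real.log δ) / Real.log n : ℝ) : EReal))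
      atTop (𝓝 ((1 : ℝ) : EReal)) :=
    (continuous_coe_real_ereal.tendsto _).comp (tendsto_log_add_log_div_log _)
  rw [← EReal.coe_one, ← hlim.limsup_eq]
  refine limsup_le_limsup ?_
  filter_upwards [(tendsto_natCast_atTop_atTop (R := ℝ)).eventually_ge_atTop (3 / δ),
    eventually_gt_atTop 1] with n hn hn1
  split_ifs with htop
  · exact le_top
  have hn0 : (0 : ℝ) < n := by positivity
  have hcount := le_boxCount_of_Ioo_subset_closure huv (n := n) (by omega)
  rw [← ENat.natCast_toNat htop, Nat.cast_le] at hcount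
  have hle : n * δ ≤ ((boxCount E n).toNat : ℝ) := by
    have h1 : ((⌊n * (v - u)⌋₊ : ℝ)) ≤ (boxCount E n).toNat + 2 := by
      exact_mod_cast Nat.sub_le_iff_le_add.1 hcount
    have h2 := Nat.lt_floor_add_one (n * (v - u))
    rw [div_le_iff₀ hδ] at hn
    have h3 : n * (v - u) = n * δ + n * δ := by simp only [δ]; ring
    linarith
  rw [EReal.coe_le_coe_iff, ← Real.log_mul hn0.ne' hδ.ne']
  exact div_le_div_of_nonneg_right (Real.log_le_log (by positivity) hle)
    (Real.log_nonneg (by exact_mod_cast hn1.le))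

lemma upperBoxDim_Icc_zero_one_le : upperBoxDim (Set.Icc 0 1) ≤ 1 := by
  have hlim : Tendsto (fun n : ℕ => (((Real.log n + Real.log 2) / Real.log n : ℝ) : EReal))
      atTop (𝓝 ((1 : ℝ) : EReal)) :=
    (continuous_coe_real_ereal.tendsto _).comp (tendsto_log_add_log_div_log _)
  rw [← EReal.coe_one, ← hlim.limsup_eq]
  refine limsup_le_limsup ?_
  filter_upwards [eventually_gt_atTop 1] with n hn1
  have hn0 : (0 : ℝ) < n := by positivity
  have hle : boxCount (Set.Icc 0 1) n ≤ ((n + 1 : ℕ) : ℕ∞) := by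
    have hsub : {k : ℤ | (Set.Icc (0 : ℝ) 1 ∩
        Set.Ico ((k : ℝ) / n) (((k : ℝ) + 1) / n)).Nonempty} ⊆
        ((Finset.Icc 0 (n : ℤ) : Finset ℤ) : Set ℤ) := by
      rintro k ⟨y, ⟨hy0, hy1⟩, hky, hyk⟩
      rw [div_le_iff₀ hn0] at hky
      rw [lt_div_iff₀ hn0] at hyk
      have h1 : (0 : ℝ) < k + 1 := lt_of_le_of_lt (by positivity) hyk
      have h2 : (k : ℝ) ≤ n := hky.trans (mul_le_of_le_one_left hn0.le hy1)
      have h1' : 0 < k + 1 := by exact_mod_cast h1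
      have h2' : k ≤ n := by exact_mod_cast h2
      simp only [Finset.coe_Icc, Set.mem_Icc]
      omega
    refine (Set.encard_le_encard hsub).trans ?_
    rw [Set.encard_coe_eq_coe_finsetCard]
    simp
  have htop : boxCount (Set.Icc 0 1) n ≠ ⊤ := ne_top_of_le_ne_top (ENat.natCast_ne_top _) hle
  rw [if_neg htop, EReal.coe_le_coe_iff, ← Real.log_mul hn0.ne' two_ne_zero]
  refine div_le_div_of_nonneg_right ?_ (Real.log_nonneg (by exact_mod_cast hn1.le))
  rcases Nat.eq_zero_or_pos (boxCount (Set.Icc 0 1) n).toNat with h0 | h0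
  · rw [h0, Nat.cast_zero, Real.log_zero]
    exact Real.log_nonneg (by norm_cast; omega)
  · refine Real.log_le_log (by exact_mod_cast h0) ?_
    rw [← ENat.natCast_toNat htop, Nat.cast_le] at hle
    norm_cast
    omega

lemma packingDim_le_one_of_subset_Icc {F : Set ℝ} (h : F ⊆ Set.Icc 0 1) : packingDim F ≤ 1 := by
  have hmem : (fun _ : ℕ => Set.Icc (0 : ℝ) 1) ∈ {E : ℕ → Set ℝ | F ⊆ ⋃ n, E n} :=
    h.trans (Set.subset_iUnion (fun _ : ℕ => Set.Icc (0 : ℝ) 1) 0)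
  exact (sInf_le (Set.mem_image_of_mem _ hmem)).trans
    (iSup_le fun _ => upperBoxDim_Icc_zero_one_le)

lemma one_le_packingDim_of_not_isMeagre {F : Set ℝ} (h : ¬ IsMeagre F) : 1 ≤ packingDim F := by
  refine le_sInf ?_
  rintro _ ⟨E, hE, rfl⟩
  obtain ⟨n, hn⟩ : ∃ n, (interior (closure (E n))).Nonempty := by
    by_contra! hempty
    exact h ((isMeagre_iUnion fun n =>
      IsNowhereDense.isMeagre (hempty n)).mono hE)
  exact (one_le_upperBoxDim_of_nonempty_interior_closure hn).trans
    (le_iSup (fun n => upperBoxDim (E n)) n)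

/-- For every regular linear transformation `T`, the set
`R_T := {x ∈ [0,1] : (Π^T(x,m))_m accumulates at every point of Δ_N}` has packing
dimension `1`. -/
theorem packingDim_RT_eq_one (N : ℕ) (hN : 2 ≤ N) (c : ℕ → ℕ → ℝ)
    (hc : IsRegularLT c) :
    packingDim {x : ℝ | x ∈ Set.Icc (0 : ℝ) 1 ∧
        ∀ p ∈ stdSimplex ℝ (Fin N), IsAccPt1 N (freqT N c x) p} = 1 := by
  refine le_antisymm (packingDim_le_one_of_subset_Icc fun x hx => hx.1)
    (one_le_packingDim_of_not_isMeagre fun hmeagre => ?_)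
  refine not_isMeagre_of_isOpen (isOpen_Ioo (a := (0 : ℝ)) (b := 1)) (by simp) ?_
  filter_upwards [hmeagre, hc.eventually_residual_isAccPt1 hN] with x hx hacc hx01
  exact hx ⟨Set.Ioo_subset_Icc_self hx01, hacc⟩
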